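/- Let x, x̂ ∈ ℝⁿ with x ≠ 0, let p ∈ ℝᵐ be nonzero, and let α > 0. Let A = (1/(α‖p‖₂²)) x pᵀ and = (1/(α‖p‖₂²)) x̂ pᵀ, let H be an n×m real matrix with H p = 0, and set à = A + H. Let σ₁ > 0 and R ≥ 1 be real numbers such that σ₁² ≤ ‖H‖_F² ≤ R σ₁². Then the relative PLD prediction error satisfies the two-sided bound: sqrt( (‖x̂ − x‖₂² + ‖α p‖₂² σ₁²) / (‖x‖₂² + ‖α p‖₂² R σ₁²) ) ≤ ‖ − Ã‖_F / ‖Ã‖_F ≤ sqrt( (‖x̂ − x‖₂² + ‖α p‖₂² R σ₁²) / (‖x‖₂² + ‖α p‖₂² σ₁²) ). -/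

import Mathlib

open scoped BigOperators

/-- The PLD (Power Level Decomposition) matrix `A = (1/(α‖p‖₂²)) x pᵀ` of a load curve `x`. -/
noncomputable def PLD {n m : ℕ} (x : EuclideanSpace ℝ (Fin n)) (p : EuclideanSpace ℝ (Fin m))
    (α : ℝ) : Matrix (Fin n) (Fin m) ℝ :=
  (1 / (α * ‖p‖ ^ 2)) • Matrix.vecMulVec (x : Fin n → ℝ) (p : Fin m → ℝ)

/-- The Frobenius norm of a real matrix. -/
noncomputable def frobNorm {n m : ℕ} (A : Matrix (Fin n) (Fin m) ℝ) : ℝ :=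
  Real.sqrt (∑ i, ∑ j, (A i j) ^ 2)

theorem frobNorm_sq {n m : ℕ} (A : Matrix (Fin n) (Fin m) ℝ) :
    frobNorm A ^ 2 = ∑ i, ∑ j, (A i j) ^ 2 :=
  Real.sq_sqrt (by positivity)

theorem frobNorm_nonneg {n m : ℕ} (A : Matrix (Fin n) (Fin m) ℝ) : 0 ≤ frobNorm A :=
  Real.sqrt_nonneg _

theorem frobNorm_neg {n m : ℕ} (A : Matrix (Fin n) (Fin m) ℝ) : frobNorm (-A) = frobNorm A := by
  simp [frobNorm]

theorem PLD_sub {n m : ℕ} (x y : EuclideanSpace ℝ (Fin n)) (p : EuclideanSpace ℝ (Fin m))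
    (α : ℝ) : PLD (x - y) p α = PLD x p α - PLD y p α := by
  simp [PLD, Matrix.sub_vecMulVec, smul_sub]

/-- Pythagoras: a perturbation annihilating `p` is Frobenius-orthogonal to every PLD matrix. -/
theorem frobNorm_PLD_add_sq {n m : ℕ} (y : EuclideanSpace ℝ (Fin n))
    {p : EuclideanSpace ℝ (Fin m)} (hp : p ≠ 0) {α : ℝ} (hα : α ≠ 0)
    {H : Matrix (Fin n) (Fin m) ℝ} (hH : H.mulVec (p : Fin m → ℝ) = 0) :
    frobNorm (PLD y p α + H) ^ 2 =
      (‖y‖ ^ 2 + ‖α • p‖ ^ 2 * frobNorm H ^ 2) / ‖α • p‖ ^ 2 := by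
  have hp' : ‖p‖ ≠ 0 := norm_ne_zero_iff.mpr hp
  have hrow (i : Fin n) : ∑ j, H i j * p j = 0 := congrFun hH i
  have key (c : ℝ) : ∑ i, ∑ j, (c * (y i * p j) + H i j) ^ 2 =
      c ^ 2 * (‖y‖ ^ 2 * ‖p‖ ^ 2) + ∑ i, ∑ j, (H i j) ^ 2 := by
    rw [EuclideanSpace.real_norm_sq_eq, EuclideanSpace.real_norm_sq_eq, Finset.sum_mul,
      Finset.mul_sum, ← Finset.sum_add_distrib]
    refine Finset.sum_congr rfl fun i _ => ?_
    calc ∑ j, (c * (y i * p j) + H i j) ^ 2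
        = ∑ j, (c ^ 2 * (y i ^ 2 * p j ^ 2) + 2 * c * y i * (H i j * p j) + H i j ^ 2) :=
          Finset.sum_congr rfl fun j _ => by ring
      _ = _ := by
          simp only [Finset.sum_add_distrib, ← Finset.mul_sum, hrow, mul_zero, add_zero]
  have hentry : frobNorm (PLD y p α + H) ^ 2 =
      ∑ i, ∑ j, (1 / (α * ‖p‖ ^ 2) * (y i * p j) + H i j) ^ 2 := by
    simp [frobNorm_sq, PLD, Matrix.vecMulVec_apply]
  rw [hentry, key, frobNorm_sq, norm_smul, mul_pow, Real.norm_eq_abs, sq_abs]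
  field_simp

/-- two-sided bound on the relative PLD prediction error `‖Â − Ã‖_F / ‖Ã‖_F`,
where `Ã = A + H`, `H p = 0`, and `σ₁² ≤ ‖H‖_F² ≤ R σ₁²`. -/
theorem stmt_6 {n m : ℕ} (x xhat : EuclideanSpace ℝ (Fin n)) (hx : x ≠ 0)
    (p : EuclideanSpace ℝ (Fin m)) (hp : p ≠ 0) (α : ℝ) (hα : 0 < α)
    (H : Matrix (Fin n) (Fin m) ℝ) (hH : H.mulVec (p : Fin m → ℝ) = 0)
    (σ₁ R : ℝ) (hσ : 0 < σ₁) (hR : 1 ≤ R)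
    (h₁ : σ₁ ^ 2 ≤ frobNorm H ^ 2) (h₂ : frobNorm H ^ 2 ≤ R * σ₁ ^ 2) :
    Real.sqrt ((‖xhat - x‖ ^ 2 + ‖α • p‖ ^ 2 * σ₁ ^ 2) / (‖x‖ ^ 2 + ‖α • p‖ ^ 2 * R * σ₁ ^ 2))
        ≤ frobNorm (PLD xhat p α - (PLD x p α + H)) / frobNorm (PLD x p α + H) ∧
      frobNorm (PLD xhat p α - (PLD x p α + H)) / frobNorm (PLD x p α + H)
        ≤ Real.sqrt ((‖xhat - x‖ ^ 2 + ‖α • p‖ ^ 2 * R * σ₁ ^ 2)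
            / (‖x‖ ^ 2 + ‖α • p‖ ^ 2 * σ₁ ^ 2)) := by
  have hs : 0 < ‖α • p‖ ^ 2 :=
    pow_pos (norm_pos_iff.mpr (smul_ne_zero hα.ne' hp)) 2
  have hx2 : 0 < ‖x‖ ^ 2 := pow_pos (norm_pos_iff.mpr hx) 2
  have hσ2 : 0 < σ₁ ^ 2 := pow_pos hσ 2
  have hsub : PLD xhat p α - (PLD x p α + H) = PLD (xhat - x) p α + -H := by
    rw [PLD_sub]; abel
  have hratio : frobNorm (PLD xhat p α - (PLD x p α + H)) / frobNorm (PLD x p α + H) =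
      Real.sqrt ((‖xhat - x‖ ^ 2 + ‖α • p‖ ^ 2 * frobNorm H ^ 2) /
        (‖x‖ ^ 2 + ‖α • p‖ ^ 2 * frobNorm H ^ 2)) := by
    rw [← Real.sqrt_sq (div_nonneg (frobNorm_nonneg _) (frobNorm_nonneg _)), div_pow, hsub,
      frobNorm_PLD_add_sq _ hp hα.ne' (by rw [Matrix.neg_mulVec, hH, neg_zero]),
      frobNorm_PLD_add_sq _ hp hα.ne' hH, frobNorm_neg, div_div_div_cancel_right₀ hs.ne']
  have hlow := mul_le_mul_of_nonneg_left h₁ hs.le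
  have hupp := mul_le_mul_of_nonneg_left h₂ hs.le
  rw [← mul_assoc] at hupp
  rw [hratio]
  constructor <;> refine Real.sqrt_le_sqrt (div_le_div₀ ?_ ?_ ?_ ?_) <;>
    first | positivity | linarith
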